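/- Let B be an affine k-domain with a fundamental pair (D,U). Then the kernel A = ker D is finitely generated as a k-algebra. Moreover, if B[X,Y] ≅ B^[2] carries the fundamental pair (D + X∂_Y, U + Y∂_X), then A is isomorphic as a k-algebra to the ring of SL₂(k)-invariants of B[X,Y], i.e., to ker(D + X∂_Y) ∩ ker(U + Y∂_X). -/

import Mathlib

/-- A derivation is locally nilpotent if every element is annihilated by some power. -/
def IsLND {R B : Type*} [CommRing R] [CommRing B] [Algebra R B]
    (D : Derivation R B B) : Prop :=
  ∀ b : B, ∃ n : ℕ, (D.toLinearMap ^ n) b = 0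

/-- The degree-`d` piece `B_d = ker([D,U] - d·id)` of the `ℤ`-grading induced by `(D, U)`. -/
def gradePiece {R B : Type*} [CommRing R] [CommRing B] [Algebra R B]
    (D U : Derivation R B B) (d : ℤ) : Submodule R B :=
  LinearMap.ker ((⁅D, U⁆ : Derivation R B B).toLinearMap
    - d • (LinearMap.id : B →ₗ[R] B))

/-- `(D, U)` is a fundamental pair: both are locally nilpotent, `[D,[D,U]] = -2D`,
`[U,[D,U]] = 2U`, and `B` is the sum of the eigenspaces of `[D,U]`. -/
def IsFundamentalPair {R B : Type*} [CommRing R] [CommRing B] [Algebra R B]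
    (D U : Derivation R B B) : Prop :=
  IsLND D ∧ IsLND U ∧
    ⁅D, ⁅D, U⁆⁆ = (-2 : ℤ) • D ∧
    ⁅U, ⁅D, U⁆⁆ = (2 : ℤ) • U ∧
    (⨆ d : ℤ, gradePiece D U d) = ⊤

/-- The kernel of a derivation, as a subalgebra. -/
def kerSubalg {R B : Type*} [CommRing R] [CommRing B] [Algebra R B]
    (D : Derivation R B B) : Subalgebra R B where
  carrier := {b : B | D b = 0}
  mul_mem' := fun {a b} ha hb => by
    simp only [Set.mem_setOf_eq] at *
    rw [D.leibniz, ha, hb, smul_zero, smul_zero, add_zero]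
  one_mem' := by simp [Set.mem_setOf_eq]
  add_mem' := fun {a b} ha hb => by
    simp only [Set.mem_setOf_eq] at *
    rw [map_add, ha, hb, add_zero]
  zero_mem' := by simp [Set.mem_setOf_eq]
  algebraMap_mem' := fun r => by simp [Set.mem_setOf_eq]

open MvPolynomial

lemma eq_zero_of_zsmul_eq_zero (k : Type*) {B : Type*} [Field k] [CharZero k] [AddCommGroup B]
    [Module k B] {n : ℤ} (hn : n ≠ 0) {b : B} (hb : n • b = 0) : b = 0 := by
  rw [← Int.cast_smul_eq_zsmul k n b] at hb
  exact (smul_eq_zero.mp hb).resolve_left (by exact_mod_cast hn)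

section FundamentalPair

variable {k B : Type*} [Field k] [CommRing B] [Algebra k B] {D U : Derivation k B B}

lemma mem_gradePiece_iff {d : ℤ} {b : B} :
    b ∈ gradePiece D U d ↔ ⁅D, U⁆ b = d • b := by
  rw [gradePiece, LinearMap.mem_ker, LinearMap.sub_apply, sub_eq_zero]
  rfl

namespace IsFundamentalPair

lemma apply_D_weight (h : IsFundamentalPair D U) (b : B) :
    D (⁅D, U⁆ b) = ⁅D, U⁆ (D b) - 2 * D b := by
  have := congrArg (fun F : Derivation k B B => F b) h.2.2.1
  rw [Derivation.commutator_apply, Derivation.smul_apply] at this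
  rw [zsmul_eq_mul] at this
  push_cast at this
  linear_combination this

lemma swap (h : IsFundamentalPair D U) : IsFundamentalPair U D := by
  obtain ⟨h1, h2, h3, h4, h5⟩ := h
  have hs : ⁅U, D⁆ = -⁅D, U⁆ := (lie_skew U D).symm
  refine ⟨h2, h1, ?_, ?_, ?_⟩
  · rw [hs, lie_neg, h4, neg_smul]
  · rw [hs, lie_neg, h3, neg_smul, neg_neg]
  · rw [eq_top_iff, ← h5, iSup_le_iff]
    intro d b hb
    refine Submodule.mem_iSup_of_mem (-d) ?_
    rw [mem_gradePiece_iff] at hb ⊢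
    rw [hs, Derivation.neg_apply, hb, neg_smul]

end IsFundamentalPair

lemma mem_gradePiece_swap {d : ℤ} {b : B} :
    b ∈ gradePiece U D d ↔ b ∈ gradePiece D U (-d) := by
  rw [mem_gradePiece_iff, mem_gradePiece_iff, ← lie_skew U D, Derivation.neg_apply, neg_smul,
    neg_eq_iff_eq_neg]

namespace IsFundamentalPair

lemma map_D_mem (h : IsFundamentalPair D U) {d : ℤ} {b : B} (hb : b ∈ gradePiece D U d) :
    D b ∈ gradePiece D U (d + 2) := by
  rw [mem_gradePiece_iff] at hb ⊢
  have h1 := h.apply_D_weight b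
  rw [hb, map_zsmul, zsmul_eq_mul] at h1
  rw [zsmul_eq_mul]
  push_cast
  linear_combination -h1

lemma map_U_mem (h : IsFundamentalPair D U) {d : ℤ} {b : B} (hb : b ∈ gradePiece D U d) :
    U b ∈ gradePiece D U (d - 2) := by
  have := h.swap.map_D_mem (d := -d) (b := b) (by rwa [mem_gradePiece_swap, neg_neg])
  rwa [mem_gradePiece_swap, neg_add, neg_neg, ← sub_eq_add_neg] at this

lemma map_D_pow_mem (h : IsFundamentalPair D U) {d : ℤ} {b : B} (hb : b ∈ gradePiece D U d)
    (n : ℕ) : (D.toLinearMap ^ n) b ∈ gradePiece D U (d + 2 * n) := by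
  induction n with
  | zero => simpa using hb
  | succ n ih =>
    rw [pow_succ']
    have := h.map_D_mem ih
    push_cast
    rw [mul_add, ← add_assoc, mul_one]
    exact this

lemma map_U_pow_mem (h : IsFundamentalPair D U) {d : ℤ} {b : B} (hb : b ∈ gradePiece D U d)
    (n : ℕ) : (U.toLinearMap ^ n) b ∈ gradePiece D U (d - 2 * n) := by
  induction n with
  | zero => simpa using hb
  | succ n ih =>
    rw [pow_succ']
    have := h.map_U_mem ih
    push_cast
    rw [mul_add, ← sub_sub, mul_one]
    exact this

lemma D_U_pow_succ (h : IsFundamentalPair D U) {d : ℤ} {b : B} (hb : b ∈ gradePiece D U d)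
    (n : ℕ) : D ((U.toLinearMap ^ (n + 1)) b) =
      (U.toLinearMap ^ (n + 1)) (D b) + ((n + 1) * (d - n) : ℤ) • (U.toLinearMap ^ n) b := by
  induction n with
  | zero =>
    rw [mem_gradePiece_iff, Derivation.commutator_apply] at hb
    simp only [zero_add, pow_one, pow_zero, Module.End.one_apply, Nat.cast_zero, sub_zero, one_mul,
      Derivation.coeFn_coe]
    linear_combination hb
  | succ n ih =>
    have hw := h.map_U_pow_mem hb (n + 1)
    rw [mem_gradePiece_iff, Derivation.commutator_apply, zsmul_eq_mul] at hw
    have ih' := congrArg U ih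
    rw [map_add, map_zsmul, zsmul_eq_mul] at ih'
    have e : ∀ x m, (U.toLinearMap ^ (m + 1)) x = U ((U.toLinearMap ^ m) x) := fun x m => by
      rw [pow_succ']; rfl
    rw [e b (n + 1), e (D b) (n + 1), zsmul_eq_mul]
    rw [← e b n] at ih'
    push_cast at hw ih' ⊢
    linear_combination hw + ih'

variable [CharZero k]

/-- A highest weight vector of weight `d` is annihilated by `U ^ m` for all `m > d`. -/
lemma U_pow_eq_zero (h : IsFundamentalPair D U) {d : ℤ} {b : B} (hb : b ∈ gradePiece D U d)
    (hD : D b = 0) {m : ℕ} (hm : d < m) : (U.toLinearMap ^ m) b = 0 := by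
  obtain ⟨n, hn⟩ := h.2.1 b
  have key : ∀ j, (U.toLinearMap ^ (m + j)) b = 0 → (U.toLinearMap ^ m) b = 0 := by
    intro j
    induction j with
    | zero => simp
    | succ j ih =>
      intro hj
      apply ih
      have := h.D_U_pow_succ hb (m + j)
      rw [← add_assoc] at hj
      rw [hj, hD, map_zero, map_zero, zero_add] at this
      refine eq_zero_of_zsmul_eq_zero k (mul_ne_zero ?_ ?_) this.symm <;> push_cast <;> omega
  apply key n
  rw [pow_add, Module.End.mul_apply, hn, map_zero]

lemma eq_zero_of_neg (h : IsFundamentalPair D U) {d : ℤ} {b : B} (hb : b ∈ gradePiece D U d)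
    (hD : D b = 0) (hd : d < 0) : b = 0 := by
  simpa using h.U_pow_eq_zero hb hD (m := 0) (by simpa using hd)

end IsFundamentalPair

lemma iSupIndep_gradePiece [CharZero k] (D U : Derivation k B B) :
    iSupIndep (gradePiece D U) := by
  have h := (Module.End.eigenspaces_iSupIndep (⁅D, U⁆ : Derivation k B B).toLinearMap).comp
    (Int.cast_injective (α := k))
  convert h using 2 with d
  ext b
  rw [mem_gradePiece_iff, Function.comp_apply, Module.End.mem_eigenspace_iff,
    Int.cast_smul_eq_zsmul]
  rfl

/-- Weight vectors of pairwise distinct weights with zero sum are zero. -/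
lemma eq_zero_of_sum_gradePiece [CharZero k] {ι : Type*} {s : Finset ι} {f : ι → ℤ}
    (hf : Set.InjOn f s) {x : ι → B} (hx : ∀ i ∈ s, x i ∈ gradePiece D U (f i))
    (h0 : ∑ i ∈ s, x i = 0) : ∀ i ∈ s, x i = 0 := by
  have hind := (iSupIndep_gradePiece D U).comp (f := fun i : s => f i)
    fun i j hij => Subtype.ext (hf i.2 j.2 hij)
  have := (iSupIndep_iff_finsetSum_eq_zero_imp_eq_zero _).mp hind s.attach (fun i => x i)
    (fun i _ => hx i i.2) (by rwa [Finset.sum_attach])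
  exact fun i hi => this ⟨i, hi⟩ (Finset.mem_attach _ _)

lemma IsFundamentalPair.exists_sum (h : IsFundamentalPair D U) (b : B) :
    ∃ (s : Finset ℤ) (x : ℤ → B), (∀ d, x d ∈ gradePiece D U d) ∧ ∑ d ∈ s, x d = b := by
  have hb : b ∈ ⨆ d, gradePiece D U d := h.2.2.2.2 ▸ Submodule.mem_top
  obtain ⟨x, hx, rfl⟩ := (Submodule.mem_iSup_iff_exists_finsupp _ _).mp hb
  exact ⟨x.support, x, hx, rfl⟩

end FundamentalPair

section Casimir

variable {k B : Type*} [Field k] [CommRing B] [Algebra k B] {D U : Derivation k B B}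

/-- The Casimir operator `4UD + E² + 2E`, where `E = [D, U]`. -/
def casimir (D U : Derivation k B B) : Module.End k B :=
  4 • (U.toLinearMap * D.toLinearMap) + (⁅D, U⁆ : Derivation k B B).toLinearMap ^ 2 +
    2 • (⁅D, U⁆ : Derivation k B B).toLinearMap

lemma casimir_apply (b : B) :
    casimir D U b = 4 * U (D b) + ⁅D, U⁆ (⁅D, U⁆ b) + 2 * ⁅D, U⁆ b := by
  rw [casimir, pow_two, LinearMap.add_apply, LinearMap.add_apply, LinearMap.smul_apply,
    LinearMap.smul_apply, nsmul_eq_mul, nsmul_eq_mul]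
  rfl

lemma casimir_swap : casimir U D = casimir D U := by
  ext b
  simp only [casimir_apply, ← lie_skew U D, Derivation.neg_apply, map_neg, neg_neg]
  simp only [Derivation.commutator_apply]
  ring

lemma derivation_natCast_mul (F : Derivation k B B) (n : ℕ) (b : B) :
    F ((n : B) * b) = n * F b := by
  rw [F.leibniz, F.map_natCast, smul_zero, add_zero, smul_eq_mul]

namespace IsFundamentalPair

lemma casimir_D (h : IsFundamentalPair D U) (b : B) :
    casimir D U (D b) = D (casimir D U b) := by
  have e2 (F : Derivation k B B) (x : B) : F (2 * x) = 2 * F x := by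
    exact_mod_cast derivation_natCast_mul F 2 x
  have e4 (F : Derivation k B B) (x : B) : F (4 * x) = 4 * F x := by
    exact_mod_cast derivation_natCast_mul F 4 x
  have h1 := h.apply_D_weight b
  have h2 := h.apply_D_weight (⁅D, U⁆ b)
  have h3 := congrArg (⁅D, U⁆ : Derivation k B B) h1
  have h4 := Derivation.commutator_apply (D1 := D) (D2 := U) (a := D b)
  rw [map_sub, e2] at h3
  rw [casimir_apply, casimir_apply, map_add, map_add, e2, e4]
  linear_combination -h2 - h3 + 4 * h4

lemma casimir_U (h : IsFundamentalPair D U) (b : B) :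
    casimir D U (U b) = U (casimir D U b) := by
  rw [← casimir_swap, h.swap.casimir_D]

lemma commute_casimir_D (h : IsFundamentalPair D U) : Commute (casimir D U) D.toLinearMap :=
  LinearMap.ext h.casimir_D

lemma casimir_mem (h : IsFundamentalPair D U) {d : ℤ} {b : B} (hb : b ∈ gradePiece D U d) :
    casimir D U b ∈ gradePiece D U d := by
  rw [mem_gradePiece_iff] at hb ⊢
  rw [← map_zsmul, ← hb, Derivation.commutator_apply, Derivation.commutator_apply, map_sub,
    ← h.casimir_U, ← h.casimir_D, ← h.casimir_D, ← h.casimir_U]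

end IsFundamentalPair

lemma casimir_of_D_eq_zero {d : ℤ} {b : B} (hb : b ∈ gradePiece D U d) (hD : D b = 0) :
    casimir D U b = (d * (d + 2)) • b := by
  rw [mem_gradePiece_iff] at hb
  rw [casimir_apply, hb, hD, map_zsmul, hb, map_zero]
  simp only [zsmul_eq_mul]
  push_cast
  ring

lemma casimir_of_mem_ker {b : B} (hD : D b = 0) (hU : U b = 0) : casimir D U b = 0 := by
  simp [casimir_apply, Derivation.commutator_apply, hD, hU]

lemma casimir_mul {a : B} (hD : D a = 0) (hU : U a = 0) (b : B) :
    casimir D U (a * b) = a * casimir D U b := by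
  have hDa (x : B) : D (a * x) = a * D x := by simp [hD]
  have hUa (x : B) : U (a * x) = a * U x := by simp [hU]
  simp only [casimir_apply, Derivation.commutator_apply, hDa, hUa, map_sub]
  ring

lemma casimir_map {P : Type*} [CommRing P] [Algebra k P] {D₁ U₁ : Derivation k P P}
    (φ : P →ₐ[k] B) (hD : ∀ p, φ (D₁ p) = D (φ p)) (hU : ∀ p, φ (U₁ p) = U (φ p)) (p : P) :
    φ (casimir D₁ U₁ p) = casimir D U (φ p) := by
  simp only [casimir_apply, Derivation.commutator_apply, map_add, map_sub, map_mul, hD, hU,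
    map_ofNat]

lemma exists_last_pow_ne_zero {M : Type*} [AddCommGroup M] [Module k M] (F : Module.End k M)
    {b : M} (hb : b ≠ 0) {n : ℕ} (hn : (F ^ n) b = 0) :
    ∃ m, (F ^ m) b ≠ 0 ∧ F ((F ^ m) b) = 0 := by
  induction n with
  | zero => exact absurd (by simpa using hn) hb
  | succ n ih =>
    by_cases h : (F ^ n) b = 0
    · exact ih h
    · exact ⟨n, h, by rwa [pow_succ', Module.End.mul_apply] at hn⟩

namespace IsFundamentalPair

variable [CharZero k]

lemma eq_zero_of_casimir_of_pos (h : IsFundamentalPair D U) {d : ℤ} {b : B}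
    (hb : b ∈ gradePiece D U d) (hd : 0 < d) (hc : casimir D U b = 0) : b = 0 := by
  by_contra hne
  obtain ⟨n, hn⟩ := h.1 b
  obtain ⟨m, hm, hm'⟩ := exists_last_pow_ne_zero _ hne hn
  have h1 := casimir_of_D_eq_zero (h.map_D_pow_mem hb m) hm'
  have h2 := LinearMap.congr_fun (h.commute_casimir_D.pow_right m) b
  rw [Module.End.mul_apply, Module.End.mul_apply, hc, map_zero, h1] at h2
  exact hm (eq_zero_of_zsmul_eq_zero k (by positivity) h2)

lemma eq_zero_of_casimir (h : IsFundamentalPair D U) {d : ℤ} {b : B}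
    (hb : b ∈ gradePiece D U d) (hd : d ≠ 0) (hc : casimir D U b = 0) : b = 0 := by
  rcases hd.lt_or_gt with hd | hd
  · exact h.swap.eq_zero_of_casimir_of_pos (d := -d) (by rwa [mem_gradePiece_swap, neg_neg])
      (by omega) (by rwa [casimir_swap])
  · exact h.eq_zero_of_casimir_of_pos hb hd hc

lemma D_eq_zero_of_casimir (h : IsFundamentalPair D U) {b : B} (hc : casimir D U b = 0) :
    D b = 0 := by
  obtain ⟨s, x, hx, rfl⟩ := h.exists_sum b
  have hc' := eq_zero_of_sum_gradePiece (f := id) Function.injective_id.injOn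
    (x := fun d => casimir D U (x d)) (s := s)
    (fun d _ => h.casimir_mem (hx d)) (by rwa [← map_sum])
  rw [map_sum]
  refine Finset.sum_eq_zero fun d hd => ?_
  rcases eq_or_ne d 0 with rfl | hd0
  · refine h.eq_zero_of_casimir (h.map_D_mem (hx 0)) (by norm_num) ?_
    rw [h.casimir_D, hc' 0 hd, map_zero]
  · rw [h.eq_zero_of_casimir (hx d) hd0 (hc' d hd), map_zero]

lemma casimir_eq_zero_iff (h : IsFundamentalPair D U) {b : B} :
    casimir D U b = 0 ↔ D b = 0 ∧ U b = 0 :=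
  ⟨fun hc => ⟨h.D_eq_zero_of_casimir hc, h.swap.D_eq_zero_of_casimir (by rwa [casimir_swap])⟩,
    fun hb => casimir_of_mem_ker hb.1 hb.2⟩

open scoped Polynomial in
lemma exists_aeval_casimir_of_mem (h : IsFundamentalPair D U) {d : ℤ} (n : ℕ) :
    ∀ {b : B}, b ∈ gradePiece D U d → (D.toLinearMap ^ n) b = 0 →
      ∃ q : k[X], q.coeff 0 ≠ 0 ∧ Polynomial.aeval (casimir D U) q (casimir D U b) = 0 := by
  induction n with
  | zero =>
    intro b _ hb
    refine ⟨1, by simp, ?_⟩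
    rw [show b = 0 by simpa using hb]
    simp
  | succ n ih =>
    intro b hb hn
    have hDn : D ((D.toLinearMap ^ n) b) = 0 := by rwa [pow_succ'] at hn
    set c : ℤ := (d + 2 * n) * (d + 2 * n + 2) with hc
    have h1 : casimir D U ((D.toLinearMap ^ n) b) = c • (D.toLinearMap ^ n) b :=
      casimir_of_D_eq_zero (h.map_D_pow_mem hb n) hDn
    have h2 : (D.toLinearMap ^ n) (casimir D U b - c • b) = 0 := by
      rw [map_sub, map_zsmul, ← h1, sub_eq_zero]
      exact (LinearMap.congr_fun (h.commute_casimir_D.pow_right n) b).symm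
    have hmem : casimir D U b - c • b ∈ gradePiece D U d :=
      sub_mem (h.casimir_mem hb) (zsmul_mem hb c)
    rcases lt_trichotomy (d + 2 * n) 0 with hneg | hzero | hpos
    · exact ih hb (h.eq_zero_of_neg (h.map_D_pow_mem hb n) hDn hneg)
    · have hc0 : c = 0 := by rw [hc, hzero, zero_mul]
      rw [hc0, zero_smul, sub_zero] at h2 hmem
      rcases n.eq_zero_or_pos with rfl | hn0
      · exact ⟨1, by simp, by simpa using h2⟩
      · have h3 : casimir D U b = 0 := by
          by_contra hne
          obtain ⟨m, hm, hm'⟩ := exists_last_pow_ne_zero _ hne h2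
          have hmn : m < n := by
            by_contra hle
            refine hm ?_
            rw [← Nat.sub_add_cancel (not_lt.mp hle), pow_add, Module.End.mul_apply, h2, map_zero]
          exact hm (h.eq_zero_of_neg (h.map_D_pow_mem hmem m) hm' (by omega))
        exact ⟨1, by simp, by rw [h3, map_zero]⟩
    · obtain ⟨q, hq, hq'⟩ := ih hmem h2
      refine ⟨q * (Polynomial.X - Polynomial.C (c : k)), ?_, ?_⟩
      · rw [Polynomial.mul_coeff_zero]
        refine mul_ne_zero hq ?_
        have : c ≠ 0 := by positivity
        rw [Polynomial.coeff_sub, Polynomial.coeff_X_zero, Polynomial.coeff_C_zero, zero_sub,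
          neg_ne_zero]
        exact_mod_cast this
      · rw [map_mul, Module.End.mul_apply]
        convert hq' using 2
        rw [map_sub, map_sub, Polynomial.aeval_X, Polynomial.aeval_C, map_zsmul,
          LinearMap.sub_apply, Module.algebraMap_end_apply, Int.cast_smul_eq_zsmul]

open scoped Polynomial in
lemma exists_aeval_casimir (h : IsFundamentalPair D U) (b : B) :
    ∃ q : k[X], q.coeff 0 ≠ 0 ∧ Polynomial.aeval (casimir D U) q (casimir D U b) = 0 := by
  obtain ⟨s, x, hx, rfl⟩ := h.exists_sum b
  induction s using Finset.induction_on with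
  | empty => exact ⟨1, by simp, by simp⟩
  | insert d s hd ih =>
    obtain ⟨q, hq, hq'⟩ := ih
    obtain ⟨n, hn⟩ := h.1 (x d)
    obtain ⟨r, hr, hr'⟩ := h.exists_aeval_casimir_of_mem n (hx d) hn
    refine ⟨q * r, by rw [Polynomial.mul_coeff_zero]; exact mul_ne_zero hq hr, ?_⟩
    rw [Finset.sum_insert hd, map_add, map_add]
    nth_rw 2 [mul_comm q r]
    rw [map_mul, map_mul, Module.End.mul_apply, Module.End.mul_apply, hq', hr', map_zero, map_zero,
      add_zero]

/-- The Casimir operator has no nonzero invariants in its image. -/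
lemma casimir_eq_zero_of_invariant (h : IsFundamentalPair D U) {b : B}
    (hD : D (casimir D U b) = 0) (hU : U (casimir D U b) = 0) : casimir D U b = 0 := by
  obtain ⟨q, hq, hq'⟩ := h.exists_aeval_casimir b
  rw [← Polynomial.divX_mul_X_add q, map_add, map_mul, Polynomial.aeval_X, Polynomial.aeval_C,
    LinearMap.add_apply, Module.End.mul_apply, casimir_of_mem_ker hD hU, map_zero, zero_add,
    Module.algebraMap_end_apply] at hq'
  exact (smul_eq_zero.mp hq').resolve_left hq

/-- Every element is the sum of an invariant and an element of the image of the Casimir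
operator. -/
lemma exists_invariant_add_casimir (h : IsFundamentalPair D U) (b : B) :
    ∃ a c, D a = 0 ∧ U a = 0 ∧ b = a + casimir D U c := by
  obtain ⟨q, hq, hq'⟩ := h.exists_aeval_casimir b
  set Ω := casimir D U with hΩ
  have hcomm : Ω (Polynomial.aeval Ω q b) = 0 := by
    rw [← hq', ← Module.End.mul_apply, ← Module.End.mul_apply]
    congr 1
    nth_rw 1 [← Polynomial.aeval_X (R := k) Ω]
    nth_rw 4 [← Polynomial.aeval_X (R := k) Ω]
    rw [← map_mul, ← map_mul, mul_comm]
  obtain ⟨hD, hU⟩ := h.casimir_eq_zero_iff.mp hcomm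
  refine ⟨(q.coeff 0)⁻¹ • Polynomial.aeval Ω q b,
    -((q.coeff 0)⁻¹ • Polynomial.aeval Ω q.divX b), by simp [hD], by simp [hU], ?_⟩
  rw [map_neg, map_smul, ← sub_eq_add_neg, ← smul_sub, eq_inv_smul_iff₀ hq]
  nth_rw 2 [← Polynomial.divX_mul_X_add q]
  rw [mul_comm, map_add, map_mul, Polynomial.aeval_X, Polynomial.aeval_C, LinearMap.add_apply,
    Module.End.mul_apply, Module.algebraMap_end_apply, add_sub_cancel_left]

end IsFundamentalPair

/-- An equivariant surjection of algebras with fundamental pairs is surjective on invariants. -/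
lemma exists_invariant_lift [CharZero k] {P : Type*} [CommRing P] [Algebra k P]
    {D₁ U₁ : Derivation k P P} (h₁ : IsFundamentalPair D₁ U₁) (h : IsFundamentalPair D U)
    (φ : P →ₐ[k] B) (hφ : Function.Surjective φ)
    (hD : ∀ p, φ (D₁ p) = D (φ p)) (hU : ∀ p, φ (U₁ p) = U (φ p))
    {b : B} (hDb : D b = 0) (hUb : U b = 0) :
    ∃ p, D₁ p = 0 ∧ U₁ p = 0 ∧ φ p = b := by
  obtain ⟨p, rfl⟩ := hφ b
  obtain ⟨a, c, ha, ha', rfl⟩ := h₁.exists_invariant_add_casimir p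
  refine ⟨a, ha, ha', ?_⟩
  rw [map_add, map_add, ← hD, ha, map_zero, zero_add, casimir_map φ hD hU] at hDb
  rw [map_add, map_add, ← hU, ha', map_zero, zero_add, casimir_map φ hD hU] at hUb
  rw [map_add, casimir_map φ hD hU, h.casimir_eq_zero_of_invariant hDb hUb, add_zero]

end Casimir

section Hilbert

variable {k σ : Type*} [Field k]

lemma derivation_apply_eq_sum_pderiv [Fintype σ]
    (F : Derivation k (MvPolynomial σ k) (MvPolynomial σ k)) (p : MvPolynomial σ k) :
    F p = ∑ i, pderiv i p * F (X i) := by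
  classical
  have sum_apply (G : σ → Derivation k (MvPolynomial σ k) (MvPolynomial σ k))
      (q : MvPolynomial σ k) : (∑ i, G i) q = ∑ i, G i q :=
    (congrFun (map_sum Derivation.coeFnAddMonoidHom G Finset.univ) q).trans
      (Finset.sum_apply q Finset.univ _)
  have : F = ∑ i, F (X i) • pderiv (R := k) i := by
    refine derivation_ext fun j => ?_
    simp only [sum_apply, Derivation.smul_apply, pderiv_X, smul_eq_mul]
    rw [Finset.sum_eq_single j] <;> simp +contextual [eq_comm]
  conv_lhs => rw [this]
  simp [sum_apply, mul_comm]

lemma isHomogeneous_derivation [Finite σ] {F : Derivation k (MvPolynomial σ k) (MvPolynomial σ k)}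
    (hF : ∀ i, (F (X i)).IsHomogeneous 1) {p : MvPolynomial σ k} {n : ℕ} (hp : p.IsHomogeneous n) :
    (F p).IsHomogeneous n := by
  cases nonempty_fintype σ
  rcases n.eq_zero_or_pos with rfl | hn
  · rw [← totalDegree_zero_iff_isHomogeneous] at hp
    rw [totalDegree_eq_zero_iff_eq_C.mp hp, derivation_C]
    exact isHomogeneous_zero _ _ _
  · rw [derivation_apply_eq_sum_pderiv]
    refine IsHomogeneous.sum _ _ _ fun i _ => ?_
    have := (hp.pderiv (i := i)).mul (hF i)
    rwa [Nat.sub_add_cancel hn] at this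

lemma homogeneousComponent_derivation [Finite σ]
    {F : Derivation k (MvPolynomial σ k) (MvPolynomial σ k)}
    (hF : ∀ i, (F (X i)).IsHomogeneous 1) (p : MvPolynomial σ k) (n : ℕ) :
    homogeneousComponent n (F p) = F (homogeneousComponent n p) := by
  conv_lhs => rw [← sum_homogeneousComponent p]
  rw [map_sum, map_sum]
  have (i : ℕ) : homogeneousComponent n (F (homogeneousComponent i p)) =
      if n = i then F (homogeneousComponent i p) else 0 := by
    rw [homogeneousComponent_of_mem (m := n)
      (isHomogeneous_derivation hF (homogeneousComponent_isHomogeneous i p))]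
  simp only [this, Finset.sum_ite_eq, Finset.mem_range]
  split_ifs with h
  · rfl
  · rw [homogeneousComponent_eq_zero _ _ (by omega), map_zero]

/-- Hilbert's finiteness theorem for a linear fundamental pair on a polynomial ring. -/
lemma invariants_fg_of_linear [CharZero k] [Finite σ]
    {D U : Derivation k (MvPolynomial σ k) (MvPolynomial σ k)} (h : IsFundamentalPair D U)
    (hD : ∀ i, (D (X i)).IsHomogeneous 1) (hU : ∀ i, (U (X i)).IsHomogeneous 1) :
    (kerSubalg D ⊓ kerSubalg U).FG := by
  set S := kerSubalg D ⊓ kerSubalg U with hS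
  have mem_S {p} : p ∈ S ↔ D p = 0 ∧ U p = 0 := Iff.rfl
  have comp_mem {p} (hp : p ∈ S) (n : ℕ) : homogeneousComponent n p ∈ S := by
    rw [mem_S, ← homogeneousComponent_derivation hD, ← homogeneousComponent_derivation hU,
      hp.1, hp.2, map_zero]
    exact ⟨rfl, rfl⟩
  let T : Set (MvPolynomial σ k) := {p | p ∈ S ∧ ∃ n, 0 < n ∧ p.IsHomogeneous n}
  obtain ⟨t, htT, ht⟩ := (Submodule.fg_span_iff_fg_span_finset_subset T).mp
    ((isNoetherianRing_iff_ideal_fg _).mp inferInstance (Ideal.span T))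
  refine ⟨t, le_antisymm (Algebra.adjoin_le fun p hp => (htT hp).1) ?_⟩
  have key : ∀ n p, p.IsHomogeneous n → p ∈ S →
      p ∈ Algebra.adjoin k (t : Set (MvPolynomial σ k)) := by
    intro n
    induction n using Nat.strong_induction_on with
    | _ n ih =>
    intro p hp hpS
    rcases n.eq_zero_or_pos with rfl | hn
    · rw [← totalDegree_zero_iff_isHomogeneous] at hp
      rw [totalDegree_eq_zero_iff_eq_C.mp hp]
      exact Subalgebra.algebraMap_mem _ _
    · have hpt : p ∈ Submodule.span (MvPolynomial σ k) (t : Set (MvPolynomial σ k)) := by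
        rw [← ht]
        exact Submodule.subset_span ⟨hpS, n, hn, hp⟩
      obtain ⟨g, -, hg⟩ := Submodule.mem_span_finset.mp hpt
      choose a c haD haU hac using fun q => h.exists_invariant_add_casimir (g q)
      have hsum : p = ∑ q ∈ t, a q * q := by
        have e : p - ∑ q ∈ t, a q * q = casimir D U (∑ q ∈ t, q * c q) := by
          rw [← hg, ← Finset.sum_sub_distrib, map_sum]
          refine Finset.sum_congr rfl fun q hq => ?_
          rw [casimir_mul (htT hq).1.1 (htT hq).1.2]
          nth_rw 1 [hac q]
          rw [smul_eq_mul]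
          ring
        have hm : p - ∑ q ∈ t, a q * q ∈ S :=
          sub_mem hpS (sum_mem fun q hq => mul_mem (mem_S.mpr ⟨haD q, haU q⟩) (htT hq).1)
        rw [e] at hm
        rw [h.casimir_eq_zero_of_invariant hm.1 hm.2] at e
        exact sub_eq_zero.mp e
      rw [← homogeneousComponent_eq_self hp, hsum, map_sum]
      refine sum_mem fun q hq => ?_
      obtain ⟨hqS, m, hm, hqm⟩ := htT hq
      have e : a q * q = ∑ i ∈ Finset.range ((a q).totalDegree + 1),
          homogeneousComponent i (a q) * q := by
        rw [← Finset.sum_mul, sum_homogeneousComponent]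
      rw [e, map_sum]
      refine sum_mem fun i _ => ?_
      rw [homogeneousComponent_of_mem (m := n)
        ((homogeneousComponent_isHomogeneous i (a q)).mul hqm)]
      split_ifs with hin
      · exact mul_mem (ih i (by omega) _ (homogeneousComponent_isHomogeneous i _)
          (comp_mem (mem_S.mpr ⟨haD q, haU q⟩) i)) (Algebra.subset_adjoin hq)
      · exact zero_mem _
  intro p hp
  rw [← sum_homogeneousComponent p]
  exact sum_mem fun i _ => key i _ (homogeneousComponent_isHomogeneous i p) (comp_mem hp i)

end Hilbert

section Generators

variable {k B : Type*} [Field k] [CommRing B] [Algebra k B] {D U : Derivation k B B}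

lemma derivation_pow_mul_eq_zero (N : ℕ) : ∀ {n m : ℕ} {a b : B}, n + m = N →
    (D.toLinearMap ^ n) a = 0 → (D.toLinearMap ^ m) b = 0 → (D.toLinearMap ^ N) (a * b) = 0 := by
  induction N with
  | zero =>
    intro n m a b hN ha hb
    obtain rfl : n = 0 := by omega
    simp [show a = 0 by simpa using ha]
  | succ N ih =>
    intro n m a b hN ha hb
    rcases n with _ | n
    · simp [show a = 0 by simpa using ha]
    rcases m with _ | m
    · simp [show b = 0 by simpa using hb]
    have e : D.toLinearMap (a * b) = a * D b + b * D a := D.leibniz a b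
    rw [pow_succ, Module.End.mul_apply, e, map_add, ih (n := n + 1) (m := m) (by omega) ha,
      ih (n := m + 1) (m := n) (by omega) hb, add_zero]
    · rwa [pow_succ] at ha
    · rwa [pow_succ] at hb

lemma isLND_of_adjoin_eq_top {T : Set B} (hT : Algebra.adjoin k T = ⊤)
    (h : ∀ x ∈ T, ∃ n : ℕ, (D.toLinearMap ^ n) x = 0) : IsLND D := by
  intro b
  have hb : b ∈ Algebra.adjoin k T := hT ▸ Algebra.mem_top
  induction hb using Algebra.adjoin_induction with
  | mem x hx => exact h x hx
  | algebraMap r => exact ⟨1, by simp⟩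
  | add x y _ _ hx hy =>
    obtain ⟨n, hn⟩ := hx
    obtain ⟨m, hm⟩ := hy
    refine ⟨n + m, ?_⟩
    rw [map_add]
    nth_rw 1 [add_comm n m]
    rw [pow_add, pow_add, Module.End.mul_apply, Module.End.mul_apply, hn, hm, map_zero, map_zero,
      add_zero]
  | mul x y _ _ hx hy =>
    obtain ⟨n, hn⟩ := hx
    obtain ⟨m, hm⟩ := hy
    exact ⟨n + m, derivation_pow_mul_eq_zero _ rfl hn hm⟩

lemma mul_mem_gradePiece {d e : ℤ} {a b : B} (ha : a ∈ gradePiece D U d)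
    (hb : b ∈ gradePiece D U e) : a * b ∈ gradePiece D U (d + e) := by
  rw [mem_gradePiece_iff] at *
  rw [Derivation.leibniz, ha, hb]
  simp only [zsmul_eq_mul, smul_eq_mul]
  push_cast
  ring

lemma iSup_gradePiece_eq_top_of_adjoin {T : Set B} (hT : Algebra.adjoin k T = ⊤)
    (h : ∀ x ∈ T, x ∈ ⨆ d, gradePiece D U d) : ⨆ d, gradePiece D U d = ⊤ := by
  rw [eq_top_iff]
  intro b _
  have hb : b ∈ Algebra.adjoin k T := hT ▸ Algebra.mem_top
  induction hb using Algebra.adjoin_induction with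
  | mem x hx => exact h x hx
  | algebraMap r => exact Submodule.mem_iSup_of_mem 0 (by simp [mem_gradePiece_iff])
  | add x y _ _ hx hy => exact add_mem (hx trivial) (hy trivial)
  | mul x y _ _ hx hy =>
    refine Submodule.iSup_induction _ (motive := fun x => x * y ∈ ⨆ d, gradePiece D U d)
      (hx trivial) (fun d x hx => ?_) (by simp) fun x₁ x₂ h₁ h₂ => by
        rw [add_mul]
        exact add_mem h₁ h₂
    refine Submodule.iSup_induction _ (motive := fun y => x * y ∈ ⨆ d, gradePiece D U d)
      (hy trivial) (fun e y hy => ?_) (by simp) fun y₁ y₂ h₁ h₂ => by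
        rw [mul_add]
        exact add_mem h₁ h₂
    exact Submodule.mem_iSup_of_mem (d + e) (mul_mem_gradePiece hx hy)

end Generators

section Linearization

variable {k B : Type*} [Field k] [CommRing B] [Algebra k B] {D U : Derivation k B B}

/-- A finite set of weight vectors whose span is stable under `D` and `U`. -/
structure IsStableSet (D U : Derivation k B B) (s : Finset B) : Prop where
  homogeneous : ∀ x ∈ s, ∃ d, x ∈ gradePiece D U d
  map_D : ∀ x ∈ s, D x ∈ Submodule.span k (s : Set B)
  map_U : ∀ x ∈ s, U x ∈ Submodule.span k (s : Set B)

namespace IsStableSet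

lemma union [DecidableEq B] {s t : Finset B} (hs : IsStableSet D U s) (ht : IsStableSet D U t) :
    IsStableSet D U (s ∪ t) := by
  have h1 : Submodule.span k (s : Set B) ≤ Submodule.span k ((s ∪ t : Finset B) : Set B) :=
    Submodule.span_mono (by simp)
  have h2 : Submodule.span k (t : Set B) ≤ Submodule.span k ((s ∪ t : Finset B) : Set B) :=
    Submodule.span_mono (by simp)
  constructor <;> intro x hx <;> rcases Finset.mem_union.mp hx with hx | hx
  exacts [hs.1 x hx, ht.1 x hx, h1 (hs.2 x hx), h2 (ht.2 x hx), h1 (hs.3 x hx), h2 (ht.3 x hx)]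

lemma map_D_mem {s : Finset B} (hs : IsStableSet D U s) {x : B}
    (hx : x ∈ Submodule.span k (s : Set B)) : D x ∈ Submodule.span k (s : Set B) := by
  have : Submodule.span k (s : Set B) ≤ (Submodule.span k (s : Set B)).comap D.toLinearMap :=
    Submodule.span_le.mpr hs.map_D
  exact this hx

lemma map_U_mem {s : Finset B} (hs : IsStableSet D U s) {x : B}
    (hx : x ∈ Submodule.span k (s : Set B)) : U x ∈ Submodule.span k (s : Set B) := by
  have : Submodule.span k (s : Set B) ≤ (Submodule.span k (s : Set B)).comap U.toLinearMap :=
    Submodule.span_le.mpr hs.map_U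
  exact this hx

end IsStableSet

namespace IsFundamentalPair

lemma exists_isStableSet_of_mem (h : IsFundamentalPair D U) {d : ℤ} {b : B}
    (hb : b ∈ gradePiece D U d) :
    ∃ s, IsStableSet D U s ∧ b ∈ Submodule.span k (s : Set B) := by
  classical
  obtain ⟨M, hM⟩ := h.1 b
  choose N hN using fun j : ℕ => h.2.1 ((D.toLinearMap ^ j) b)
  set K := ∑ j ∈ Finset.range M, N j
  let w : ℕ → ℕ → B := fun i j => (U.toLinearMap ^ i) ((D.toLinearMap ^ j) b)
  let s : Finset B := (Finset.range K ×ˢ Finset.range M).image fun p => w p.1 p.2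
  have hw (i j : ℕ) : w i j ∈ Submodule.span k (s : Set B) := by
    by_cases hj : j < M
    · by_cases hi : i < K
      · exact Submodule.subset_span (Finset.mem_coe.mpr (Finset.mem_image.mpr
          ⟨(i, j), by simp [hi, hj], rfl⟩))
      · have : N j ≤ i := (Finset.single_le_sum (f := N) (fun _ _ => Nat.zero_le _)
          (Finset.mem_range.mpr hj)).trans (not_lt.mp hi)
        have e : w i j = 0 := by
          simp only [w]
          rw [← Nat.sub_add_cancel this, pow_add, Module.End.mul_apply, hN, map_zero]
        rw [e]
        exact zero_mem _
    · have e : w i j = 0 := by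
        simp only [w]
        rw [← Nat.sub_add_cancel (not_lt.mp hj), pow_add, Module.End.mul_apply, hM, map_zero,
          map_zero]
      rw [e]
      exact zero_mem _
  refine ⟨s, ⟨fun x hx => ?_, fun x hx => ?_, fun x hx => ?_⟩, hw 0 0⟩ <;>
    obtain ⟨⟨i, j⟩, -, rfl⟩ := Finset.mem_image.mp hx
  · exact ⟨_, h.map_U_pow_mem (h.map_D_pow_mem hb j) i⟩
  · have hD (i j : ℕ) : (U.toLinearMap ^ i) (D ((D.toLinearMap ^ j) b)) = w i (j + 1) := by
      simp only [w]
      rw [pow_succ' D.toLinearMap]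
      rfl
    rcases i with _ | i
    · have := hD 0 j
      simp only [pow_zero, Module.End.one_apply] at this
      simp only [w, pow_zero, Module.End.one_apply, this]
      exact hw 0 (j + 1)
    · simp only [w]
      rw [h.D_U_pow_succ (h.map_D_pow_mem hb j), hD]
      exact add_mem (hw _ _) (zsmul_mem (hw i j) _)
  · have : U (w i j) = w (i + 1) j := by
      simp only [w]
      rw [pow_succ' U.toLinearMap]
      rfl
    rw [this]
    exact hw _ _

lemma exists_isStableSet (h : IsFundamentalPair D U) (b : B) :
    ∃ s, IsStableSet D U s ∧ b ∈ Submodule.span k (s : Set B) := by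
  classical
  have hb : b ∈ ⨆ d, gradePiece D U d := h.2.2.2.2 ▸ Submodule.mem_top
  induction hb using Submodule.iSup_induction' with
  | mem d b hb => exact h.exists_isStableSet_of_mem hb
  | zero => exact ⟨∅, ⟨by simp, by simp, by simp⟩, zero_mem _⟩
  | add x y _ _ hx hy =>
    obtain ⟨s, hs, hxs⟩ := hx
    obtain ⟨t, ht, hyt⟩ := hy
    exact ⟨s ∪ t, hs.union ht, add_mem (Submodule.span_mono (by simp) hxs)
      (Submodule.span_mono (by simp) hyt)⟩

lemma exists_isStableSet_subset (h : IsFundamentalPair D U) (t : Finset B) :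
    ∃ s, IsStableSet D U s ∧ (t : Set B) ⊆ Submodule.span k (s : Set B) := by
  classical
  induction t using Finset.induction_on with
  | empty => exact ⟨∅, ⟨by simp, by simp, by simp⟩, by simp⟩
  | insert b t _ ih =>
    obtain ⟨s, hs, hts⟩ := ih
    obtain ⟨s', hs', hb⟩ := h.exists_isStableSet b
    refine ⟨s ∪ s', hs.union hs', ?_⟩
    rw [Finset.coe_insert, Set.insert_subset_iff]
    exact ⟨Submodule.span_mono (by simp) hb,
      hts.trans (Submodule.span_mono (R := k) (s := (s : Set B)) (by simp))⟩

end IsFundamentalPair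

/-- A finitely generated algebra with a fundamental pair is an equivariant quotient of a polynomial
ring with a linear fundamental pair. -/
lemma IsFundamentalPair.exists_linearization [Algebra.FiniteType k B] (h : IsFundamentalPair D U) :
    ∃ (n : ℕ) (D₁ U₁ : Derivation k (MvPolynomial (Fin n) k) (MvPolynomial (Fin n) k))
      (φ : MvPolynomial (Fin n) k →ₐ[k] B),
      IsFundamentalPair D₁ U₁ ∧ (∀ i, (D₁ (X i)).IsHomogeneous 1) ∧
      (∀ i, (U₁ (X i)).IsHomogeneous 1) ∧ Function.Surjective φ ∧
      (∀ p, φ (D₁ p) = D (φ p)) ∧ ∀ p, φ (U₁ p) = U (φ p) := by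
  obtain ⟨t, ht⟩ := (Algebra.FiniteType.out : (⊤ : Subalgebra k B).FG)
  obtain ⟨s, hs, hts⟩ := h.exists_isStableSet_subset t
  set V := Submodule.span k (s : Set B) with hV
  let bV := Module.finBasis k V
  set n := Module.finrank k V
  let P := MvPolynomial (Fin n) k
  let ℓ : V →ₗ[k] P := bV.constr k X
  have hℓ (i) : ℓ (bV i) = X i := bV.constr_basis k _ i
  let φ : P →ₐ[k] B := aeval fun i => (bV i : B)
  have hφ (v : V) : φ (ℓ v) = v := by
    have : φ.toLinearMap ∘ₗ ℓ = V.subtype := bV.ext fun i => by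
      simp only [LinearMap.comp_apply, hℓ]
      exact aeval_X _ i
    exact LinearMap.congr_fun this v
  have hhom (v : V) : (ℓ v).IsHomogeneous 1 := by
    rw [← mem_homogeneousSubmodule, homogeneousSubmodule_one_eq_span_X, bV.constr_apply_fintype k]
    exact sum_mem fun i _ => Submodule.smul_mem _ _ (Submodule.subset_span ⟨i, rfl⟩)
  have lift (F : Derivation k B B) (hF : ∀ x ∈ V, F x ∈ V) :
      ∃ F₁ : Derivation k P P, (∀ x (hx : x ∈ V), F₁ (ℓ ⟨x, hx⟩) = ℓ ⟨F x, hF x hx⟩) ∧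
        ∀ p, φ (F₁ p) = F (φ p) := by
    let FV : V →ₗ[k] V := F.toLinearMap.restrict hF
    let F₁ : Derivation k P P := mkDerivation k fun i => ℓ (FV (bV i))
    have h1 : F₁.toLinearMap ∘ₗ ℓ = ℓ ∘ₗ FV := bV.ext fun i => by
      simp only [LinearMap.comp_apply, hℓ]
      exact mkDerivation_X k _ i
    refine ⟨F₁, fun x hx => LinearMap.congr_fun h1 ⟨x, hx⟩, fun p => ?_⟩
    induction p using MvPolynomial.induction_on with
    | C a =>
      rw [derivation_C, map_zero, ← algebraMap_eq, AlgHom.commutes, F.map_algebraMap]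
    | add p q hp hq => simp only [map_add, hp, hq]
    | mul_X p i hp =>
      have h2 : φ (F₁ (X i)) = F (φ (X i)) := by
        rw [← hℓ i, hφ]
        exact (congrArg φ (LinearMap.congr_fun h1 (bV i))).trans (hφ _)
      simp only [Derivation.leibniz, map_add, smul_eq_mul, map_mul, hp, h2]
  obtain ⟨D₁, hD₁, hφD⟩ := lift D fun x => hs.map_D_mem
  obtain ⟨U₁, hU₁, hφU⟩ := lift U fun x => hs.map_U_mem
  have hℓ' (i) : X i = ℓ ⟨bV i, (bV i).2⟩ := (hℓ i).symm
  have hgen : Algebra.adjoin k (Set.range (X : Fin n → P)) = ⊤ := adjoin_range_X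
  have hpow (F : Derivation k B B) (F₁ : Derivation k P P) (hF : ∀ x ∈ V, F x ∈ V)
      (hF₁ : ∀ x (hx : x ∈ V), F₁ (ℓ ⟨x, hx⟩) = ℓ ⟨F x, hF x hx⟩) (m : ℕ) :
      ∀ x (hx : x ∈ V), (F.toLinearMap ^ m) x = 0 → (F₁.toLinearMap ^ m) (ℓ ⟨x, hx⟩) = 0 := by
    induction m with
    | zero =>
      intro x hx h0
      have : x = 0 := h0
      subst this
      exact map_zero ℓ
    | succ m ih =>
      intro x hx h0
      rw [pow_succ, Module.End.mul_apply] at h0 ⊢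
      have := ih _ (hF x hx) h0
      rwa [← hF₁ x hx] at this
  have hEV (x) (hx : x ∈ V) : ⁅D, U⁆ x ∈ V := by
    rw [Derivation.commutator_apply]
    exact sub_mem (hs.map_D_mem (hs.map_U_mem hx)) (hs.map_U_mem (hs.map_D_mem hx))
  have hE (x) (hx : x ∈ V) : ⁅D₁, U₁⁆ (ℓ ⟨x, hx⟩) = ℓ ⟨⁅D, U⁆ x, hEV x hx⟩ := by
    rw [Derivation.commutator_apply, hU₁, hD₁, hD₁, hU₁, ← map_sub]
    rfl
  refine ⟨n, D₁, U₁, φ, ⟨?_, ?_, ?_, ?_, ?_⟩, ?_, ?_, ?_, hφD, hφU⟩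
  · refine isLND_of_adjoin_eq_top hgen ?_
    rintro _ ⟨i, rfl⟩
    obtain ⟨m, hm⟩ := h.1 (bV i)
    exact ⟨m, hℓ' i ▸ hpow D D₁ _ hD₁ m _ _ hm⟩
  · refine isLND_of_adjoin_eq_top hgen ?_
    rintro _ ⟨i, rfl⟩
    obtain ⟨m, hm⟩ := h.2.1 (bV i)
    exact ⟨m, hℓ' i ▸ hpow U U₁ _ hU₁ m _ _ hm⟩
  · refine derivation_ext fun i => ?_
    rw [hℓ' i, Derivation.commutator_apply, Derivation.smul_apply, hE, hD₁, hD₁, hE, ← map_sub,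
      ← map_zsmul]
    congr 1
    exact Subtype.ext (congrArg (fun F : Derivation k B B => F (bV i)) h.2.2.1)
  · refine derivation_ext fun i => ?_
    rw [hℓ' i, Derivation.commutator_apply, Derivation.smul_apply, hE, hU₁, hU₁, hE, ← map_sub,
      ← map_zsmul]
    congr 1
    exact Subtype.ext (congrArg (fun F : Derivation k B B => F (bV i)) h.2.2.2.1)
  · have key : ∀ x (hx : x ∈ V), ℓ ⟨x, hx⟩ ∈ ⨆ d, gradePiece D₁ U₁ d := by
      intro x hx
      induction hx using Submodule.span_induction with
      | mem x hx =>
        obtain ⟨d, hd⟩ := hs.homogeneous x hx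
        refine Submodule.mem_iSup_of_mem d ?_
        rw [mem_gradePiece_iff] at hd ⊢
        rw [hE, ← map_zsmul]
        congr 2
      | zero => exact (map_zero ℓ).symm ▸ zero_mem _
      | add x y hx hy hx' hy' => exact (map_add ℓ ⟨x, hx⟩ ⟨y, hy⟩).symm ▸ add_mem hx' hy'
      | smul r x hx hx' => exact (map_smul ℓ r ⟨x, hx⟩).symm ▸ Submodule.smul_mem _ r hx'
    refine iSup_gradePiece_eq_top_of_adjoin hgen ?_
    rintro _ ⟨i, rfl⟩
    exact hℓ' i ▸ key _ _
  · intro i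
    rw [hℓ' i, hD₁]
    exact hhom _
  · intro i
    rw [hℓ' i, hU₁]
    exact hhom _
  · rw [← AlgHom.range_eq_top, eq_top_iff, ← ht]
    exact Algebra.adjoin_le fun x hx => ⟨ℓ ⟨x, hts hx⟩, hφ _⟩

/-- The invariants of a fundamental pair on a finitely generated algebra are finitely generated. -/
lemma IsFundamentalPair.invariants_fg [CharZero k] [Algebra.FiniteType k B]
    (h : IsFundamentalPair D U) : (kerSubalg D ⊓ kerSubalg U).FG := by
  obtain ⟨n, D₁, U₁, φ, h₁, hD, hU, hφ, hφD, hφU⟩ := h.exists_linearization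
  suffices e : kerSubalg D ⊓ kerSubalg U = (kerSubalg D₁ ⊓ kerSubalg U₁).map φ by
    rw [e]
    exact (invariants_fg_of_linear h₁ hD hU).map φ
  ext b
  constructor
  · rintro ⟨hDb, hUb⟩
    obtain ⟨p, hp, hp', rfl⟩ := exists_invariant_lift h₁ h φ hφ hφD hφU hDb hUb
    exact ⟨p, ⟨hp, hp'⟩, rfl⟩
  · rintro ⟨p, ⟨hp, hp'⟩, rfl⟩
    refine ⟨(hφD p).symm.trans ?_, (hφU p).symm.trans ?_⟩
    · rw [show D₁ p = 0 from hp, map_zero]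
    · rw [show U₁ p = 0 from hp', map_zero]

end Linearization

section Extension

variable {k B : Type*} [Field k] [CommRing B] [Algebra k B] {D U : Derivation k B B}

/-- `D'` and `U'` are the derivations `D + X∂_Y` and `U + Y∂_X` of `B[X, Y]`. -/
structure IsStandardExtension (D U : Derivation k B B)
    (D' U' : Derivation k (MvPolynomial (Fin 2) B) (MvPolynomial (Fin 2) B)) : Prop where
  D_C : ∀ b : B, D' (C b) = C (D b)
  D_X : D' (X 0) = 0
  D_Y : D' (X 1) = X 0
  U_C : ∀ b : B, U' (C b) = C (U b)
  U_X : U' (X 0) = X 1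
  U_Y : U' (X 1) = 0

lemma adjoin_range_C_union_range_X (σ : Type*) :
    Algebra.adjoin k (Set.range (C : B → MvPolynomial σ B) ∪ Set.range X) = ⊤ := by
  rw [eq_top_iff]
  intro p _
  induction p using MvPolynomial.induction_on with
  | C b => exact Algebra.subset_adjoin (Or.inl ⟨b, rfl⟩)
  | add p q hp hq => exact add_mem (hp trivial) (hq trivial)
  | mul_X p i hp => exact mul_mem (hp trivial) (Algebra.subset_adjoin (Or.inr ⟨i, rfl⟩))

lemma coeff_derivation_of_map_X_eq_zero {σ : Type*} {F : Derivation k B B}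
    {F' : Derivation k (MvPolynomial σ B) (MvPolynomial σ B)} (hC : ∀ b, F' (C b) = C (F b))
    (hX : ∀ i, F' (X i) = 0) (p : MvPolynomial σ B) : ∀ m, coeff m (F' p) = F (coeff m p) := by
  classical
  induction p using MvPolynomial.induction_on with
  | C b =>
    intro m
    rw [hC, coeff_C, coeff_C]
    split_ifs <;> simp
  | add p q hp hq => intro m; simp only [map_add, coeff_add, hp, hq]
  | mul_X p i hp =>
    intro m
    rw [Derivation.leibniz, hX, smul_zero, zero_add, smul_eq_mul, mul_comm, coeff_mul_X',
      coeff_mul_X']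
    split_ifs
    · exact hp _
    · simp

lemma coeff_X_mul_pderiv {σ R : Type*} [CommSemiring R] (i : σ) (p : MvPolynomial σ R)
    (m : σ →₀ ℕ) : coeff m (X i * pderiv i p) = m i * coeff m p := by
  classical
  induction p using MvPolynomial.induction_on' with
  | monomial s r =>
    rw [X_mul_pderiv_monomial, nsmul_eq_mul, ← map_natCast (C : R →+* MvPolynomial σ R),
      coeff_C_mul, coeff_monomial]
    split_ifs with h
    · rw [h]
    · simp
  | add p q hp hq => rw [map_add, mul_add, coeff_add, coeff_add, hp, hq, mul_add]

namespace IsStandardExtension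

variable {D' U' : Derivation k (MvPolynomial (Fin 2) B) (MvPolynomial (Fin 2) B)}

lemma weight_C (h : IsStandardExtension D U D' U') (b : B) : ⁅D', U'⁆ (C b) = C (⁅D, U⁆ b) := by
  simp only [Derivation.commutator_apply, h.D_C, h.U_C, map_sub]

lemma weight_X (h : IsStandardExtension D U D' U') : ⁅D', U'⁆ (X 0) = X 0 := by
  simp only [Derivation.commutator_apply, h.D_X, h.U_X, h.D_Y, map_zero, sub_zero]

lemma weight_Y (h : IsStandardExtension D U D' U') : ⁅D', U'⁆ (X 1) = -X 1 := by
  simp only [Derivation.commutator_apply, h.U_X, h.U_Y, h.D_Y, map_zero, zero_sub]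

lemma isFundamentalPair (h : IsStandardExtension D U D' U') (hDU : IsFundamentalPair D U) :
    IsFundamentalPair D' U' := by
  have hT := adjoin_range_C_union_range_X (k := k) (B := B) (Fin 2)
  refine ⟨isLND_of_adjoin_eq_top hT ?_, isLND_of_adjoin_eq_top hT ?_,
    Derivation.ext_of_adjoin_eq_top _ hT ?_, Derivation.ext_of_adjoin_eq_top _ hT ?_,
    iSup_gradePiece_eq_top_of_adjoin hT ?_⟩
  · rintro _ (⟨b, rfl⟩ | ⟨i, rfl⟩)
    · obtain ⟨n, hn⟩ := hDU.1 b
      have (m : ℕ) : (D'.toLinearMap ^ m) (C b) = C ((D.toLinearMap ^ m) b) := by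
        induction m with
        | zero => rfl
        | succ m ih =>
          rw [pow_succ', pow_succ', Module.End.mul_apply, ih]
          exact h.D_C _
      exact ⟨n, by rw [this, hn, map_zero]⟩
    · refine ⟨2, ?_⟩
      rw [pow_two]
      change D' (D' (X i)) = 0
      fin_cases i
      · simp [h.D_X]
      · simp [h.D_X, h.D_Y]
  · rintro _ (⟨b, rfl⟩ | ⟨i, rfl⟩)
    · obtain ⟨n, hn⟩ := hDU.2.1 b
      have (m : ℕ) : (U'.toLinearMap ^ m) (C b) = C ((U.toLinearMap ^ m) b) := by
        induction m with
        | zero => rfl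
        | succ m ih =>
          rw [pow_succ', pow_succ', Module.End.mul_apply, ih]
          exact h.U_C _
      exact ⟨n, by rw [this, hn, map_zero]⟩
    · refine ⟨2, ?_⟩
      rw [pow_two]
      change U' (U' (X i)) = 0
      fin_cases i
      · simp [h.U_X, h.U_Y]
      · simp [h.U_Y]
  · rintro _ (⟨b, rfl⟩ | ⟨i, rfl⟩)
    · rw [Derivation.commutator_apply, Derivation.smul_apply, h.weight_C, h.D_C, h.D_C, h.weight_C,
        ← map_sub, ← map_zsmul]
      exact congrArg (fun F : Derivation k B B => C (F b)) hDU.2.2.1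
    · rw [Derivation.commutator_apply, Derivation.smul_apply]
      fin_cases i
      · simp [h.weight_X, h.D_X]
      · simp only [Fin.mk_one, h.weight_Y, h.D_Y, h.weight_X, map_neg, zsmul_eq_mul]
        push_cast
        ring
  · rintro _ (⟨b, rfl⟩ | ⟨i, rfl⟩)
    · rw [Derivation.commutator_apply, Derivation.smul_apply, h.weight_C, h.U_C, h.U_C, h.weight_C,
        ← map_sub, ← map_zsmul]
      exact congrArg (fun F : Derivation k B B => C (F b)) hDU.2.2.2.1
    · rw [Derivation.commutator_apply, Derivation.smul_apply]
      fin_cases i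
      · simp only [Fin.zero_eta, h.weight_Y, h.U_X, h.weight_X, zsmul_eq_mul]
        push_cast
        ring
      · simp [h.weight_Y, h.U_Y]
  · rintro _ (⟨b, rfl⟩ | ⟨i, rfl⟩)
    · obtain ⟨s, x, hx, rfl⟩ := hDU.exists_sum b
      rw [map_sum]
      refine sum_mem fun d _ => Submodule.mem_iSup_of_mem d ?_
      rw [mem_gradePiece_iff, h.weight_C, mem_gradePiece_iff.mp (hx d), map_zsmul]
    · fin_cases i
      · exact Submodule.mem_iSup_of_mem 1 (by simp [mem_gradePiece_iff, h.weight_X])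
      · exact Submodule.mem_iSup_of_mem (-1) (by simp [mem_gradePiece_iff, h.weight_Y])

lemma coeff_weight (h : IsStandardExtension D U D' U') (f : MvPolynomial (Fin 2) B)
    (m : Fin 2 →₀ ℕ) :
    coeff m (⁅D', U'⁆ f) = ⁅D, U⁆ (coeff m f) + (m 0 : B) * coeff m f - m 1 * coeff m f := by
  have key := coeff_derivation_of_map_X_eq_zero (F := ⁅D, U⁆)
    (F' := ⁅D', U'⁆ - (X 0 : MvPolynomial (Fin 2) B) • (pderiv 0).restrictScalars k
      + (X 1 : MvPolynomial (Fin 2) B) • (pderiv 1).restrictScalars k)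
    (fun b => by simp [h.weight_C])
    (fun i => by
      fin_cases i
      · simp [h.weight_X]
      · simp [h.weight_Y]) f m
  simp only [Derivation.add_apply, Derivation.sub_apply, Derivation.smul_apply,
    Derivation.restrictScalars_apply, smul_eq_mul, coeff_add, coeff_sub, coeff_X_mul_pderiv] at key
  linear_combination key

lemma coeff_U (h : IsStandardExtension D U D' U') (f : MvPolynomial (Fin 2) B)
    (m : Fin 2 →₀ ℕ) :
    coeff (m + Finsupp.single 1 1) (U' f) =
      U (coeff (m + Finsupp.single 1 1) f) + (m 0 + 1) * coeff (m + Finsupp.single 0 1) f := by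
  have key := coeff_derivation_of_map_X_eq_zero (F := U)
    (F' := U' - (X 1 : MvPolynomial (Fin 2) B) • (pderiv 0).restrictScalars k)
    (fun b => by simp [h.U_C])
    (fun i => by
      fin_cases i
      · simp [h.U_X]
      · simp [h.U_Y]) f (m + Finsupp.single 1 1)
  have e := coeff_X_mul_pderiv 0 f (m + Finsupp.single 0 1)
  rw [add_comm m, coeff_X_mul] at e
  simp only [Derivation.sub_apply, Derivation.smul_apply, Derivation.restrictScalars_apply,
    smul_eq_mul, coeff_sub] at key
  rw [add_comm m (Finsupp.single 1 1), coeff_X_mul, e] at key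
  rw [add_comm m, add_comm m]
  simp only [Finsupp.add_apply, Finsupp.single_eq_same, Nat.cast_add, Nat.cast_one] at key
  linear_combination key

/-- Evaluation at `X = 0`, `Y = 1`. -/
noncomputable def evalZeroOne (k B : Type*) [Field k] [CommRing B] [Algebra k B] :
    MvPolynomial (Fin 2) B →ₐ[k] B :=
  (aeval ![0, 1] : MvPolynomial (Fin 2) B →ₐ[B] B).restrictScalars k

lemma evalZeroOne_C (b : B) : evalZeroOne k B (C b) = b := by simp [evalZeroOne]

lemma evalZeroOne_X : evalZeroOne k B (X 0) = 0 := by simp [evalZeroOne]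

lemma evalZeroOne_Y : evalZeroOne k B (X 1) = 1 := by simp [evalZeroOne]

lemma evalZeroOne_apply (f : MvPolynomial (Fin 2) B) :
    evalZeroOne k B f = ∑ m ∈ f.support with m 0 = 0, coeff m f := by
  rw [Finset.sum_filter]
  have : evalZeroOne k B f = eval ![0, 1] f := rfl
  rw [this, eval_eq']
  refine Finset.sum_congr rfl fun m _ => ?_
  split_ifs with hm <;> simp [Fin.prod_univ_two, hm]

lemma evalZeroOne_D (h : IsStandardExtension D U D' U') (f : MvPolynomial (Fin 2) B) :
    evalZeroOne k B (D' f) = D (evalZeroOne k B f) := by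
  induction f using MvPolynomial.induction_on with
  | C b => rw [h.D_C, evalZeroOne_C, evalZeroOne_C]
  | add p q hp hq => simp only [map_add, hp, hq]
  | mul_X p i hp =>
    have hi : evalZeroOne k B (D' (X i)) = D (evalZeroOne k B (X i)) := by
      fin_cases i
      · simp [h.D_X, evalZeroOne_X]
      · simp [h.D_Y, evalZeroOne_X, evalZeroOne_Y]
    simp only [Derivation.leibniz, map_add, smul_eq_mul, map_mul, hp, hi]

variable [CharZero k]

lemma eq_zero_of_evalZeroOne (h : IsStandardExtension D U D' U') {f : MvPolynomial (Fin 2) B}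
    (hD : D' f = 0) (hU : U' f = 0) (hf : evalZeroOne k B f = 0) : f = 0 := by
  have hw (m : Fin 2 →₀ ℕ) : coeff m f ∈ gradePiece D U (m 1 - m 0 : ℤ) := by
    have := h.coeff_weight f m
    rw [Derivation.commutator_apply, hD, hU, map_zero, map_zero, sub_zero, coeff_zero] at this
    rw [mem_gradePiece_iff, zsmul_eq_mul]
    push_cast
    linear_combination -this
  rw [evalZeroOne_apply] at hf
  have hinj : Set.InjOn (fun m : Fin 2 →₀ ℕ => (m 1 - m 0 : ℤ))
      ((f.support.filter fun m => m 0 = 0 : Finset (Fin 2 →₀ ℕ)) : Set (Fin 2 →₀ ℕ)) := by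
    intro m hm n hn hmn
    have hm0 : m 0 = 0 := (Finset.mem_filter.mp hm).2
    have hn0 : n 0 = 0 := (Finset.mem_filter.mp hn).2
    simp only [hm0, hn0] at hmn
    ext i
    fin_cases i
    · exact hm0.trans hn0.symm
    · change m 1 = n 1
      omega
  have h0 := eq_zero_of_sum_gradePiece hinj (fun m _ => hw m) hf
  have key : ∀ (i : ℕ) (m : Fin 2 →₀ ℕ), m 0 = i → coeff m f = 0 := by
    intro i
    induction i with
    | zero =>
      intro m hm
      by_contra hne
      exact hne (h0 m (Finset.mem_filter.mpr ⟨mem_support_iff.mpr hne, hm⟩))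
    | succ i ih =>
      intro m hm
      obtain ⟨n, rfl⟩ : ∃ n, m = n + Finsupp.single 0 1 := by
        refine ⟨m - Finsupp.single 0 1, (tsub_add_cancel_of_le ?_).symm⟩
        rw [Finsupp.single_le_iff]
        omega
      have hn : n 0 = i := by simpa using hm
      have hc := h.coeff_U f n
      rw [hU, ih (n + Finsupp.single 1 1) (by simpa using hn), map_zero, coeff_zero, zero_add,
        hn] at hc
      refine eq_zero_of_zsmul_eq_zero k (n := (i + 1 : ℤ)) (by omega) ?_
      rw [zsmul_eq_mul]
      push_cast
      exact hc.symm
  ext m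
  rw [key _ m rfl, coeff_zero]

/-- A highest weight vector `a` of weight `n` is the value at `(0, 1)` of the invariant
`∑ i, (-1)^i / i! • U^i a • X^i Y^(n-i)`. -/
lemma exists_invariant_of_mem (h : IsStandardExtension D U D' U') (hDU : IsFundamentalPair D U)
    {n : ℕ} {a : B} (ha : a ∈ gradePiece D U n) (hDa : D a = 0) :
    ∃ f, D' f = 0 ∧ U' f = 0 ∧ evalZeroOne k B f = a := by
  let t : ℕ → B := fun i => ((-1) ^ i / (i.factorial : k)) • (U.toLinearMap ^ i) a
  have ht0 : t 0 = a := by simp [t]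
  have htn : t (n + 1) = 0 := by
    simp only [t]
    rw [hDU.U_pow_eq_zero ha hDa (by push_cast; omega), smul_zero]
  have hfac (i : ℕ) : (-1 : k) ^ (i + 1) / ((i + 1).factorial : k) * (i + 1) =
      -((-1) ^ i / (i.factorial : k)) := by
    have h1 : (i.factorial : k) ≠ 0 := by exact_mod_cast i.factorial_ne_zero
    have h2 : (i + 1 : k) ≠ 0 := by exact_mod_cast i.succ_ne_zero
    rw [Nat.factorial_succ]
    push_cast
    field_simp
    ring
  have hUt (i : ℕ) : U (t i) = -((i + 1 : B) * t (i + 1)) := by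
    have e : (U.toLinearMap ^ (i + 1)) a = U ((U.toLinearMap ^ i) a) := by
      rw [pow_succ']
      rfl
    simp only [t]
    rw [e, Derivation.map_smul, ← neg_eq_iff_eq_neg, ← neg_smul, ← hfac i, mul_comm, mul_smul]
    simp [Algebra.smul_def]
  have hDt (i : ℕ) : D (t (i + 1)) = -((n - i : B) * t i) := by
    simp only [t]
    rw [Derivation.map_smul, hDU.D_U_pow_succ ha i, hDa, map_zero, zero_add, ← neg_eq_iff_eq_neg,
      ← Int.cast_smul_eq_zsmul k, smul_smul]
    push_cast
    rw [← mul_assoc, hfac i]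
    simp [Algebra.smul_def]
    ring
  refine ⟨∑ i ∈ Finset.range (n + 1), C (t i) * (X 0 ^ i * X 1 ^ (n - i)), ?_, ?_, ?_⟩
  · have hterm (i : ℕ) : D' (C (t i) * (X 0 ^ i * X 1 ^ (n - i))) =
        C (D (t i)) * (X 0 ^ i * X 1 ^ (n - i)) +
          ((n - i : ℕ) : MvPolynomial (Fin 2) B) * C (t i) *
            (X 0 ^ (i + 1) * X 1 ^ (n - i - 1)) := by
      simp only [Derivation.leibniz, Derivation.leibniz_pow, h.D_C, h.D_X, h.D_Y, smul_eq_mul,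
        nsmul_eq_mul, mul_zero, add_zero]
      ring
    rw [map_sum, Finset.sum_congr rfl fun i _ => hterm i, Finset.sum_add_distrib,
      Finset.sum_range_succ', Finset.sum_range_succ, ht0, hDa, Nat.sub_self, Nat.cast_zero]
    simp only [map_zero, zero_mul, add_zero]
    rw [← Finset.sum_add_distrib]
    refine Finset.sum_eq_zero fun i hi => ?_
    have hi' : i ≤ n := (Finset.mem_range.mp hi).le
    rw [hDt, Nat.cast_sub hi', Nat.sub_sub]
    simp only [map_neg, map_mul, map_sub, map_natCast]
    ring
  · let F : ℕ → MvPolynomial (Fin 2) B := fun i =>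
      (i : MvPolynomial (Fin 2) B) * C (t i) * (X 0 ^ (i - 1) * X 1 ^ (n + 1 - i))
    have hterm (i : ℕ) (hi : i ∈ Finset.range (n + 1)) :
        U' (C (t i) * (X 0 ^ i * X 1 ^ (n - i))) = -(F (i + 1) - F i) := by
      have hi' : n + 1 - i = n - i + 1 := by have := Finset.mem_range.mp hi; omega
      simp only [F, Derivation.leibniz, Derivation.leibniz_pow, h.U_C, h.U_X, h.U_Y, smul_eq_mul,
        nsmul_eq_mul, mul_zero, zero_add, hUt, hi', Nat.add_sub_cancel, Nat.add_sub_add_right,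
        map_neg, map_mul, map_add, map_natCast, map_one, Nat.cast_add, Nat.cast_one]
      ring
    rw [map_sum, Finset.sum_congr rfl hterm, Finset.sum_neg_distrib, Finset.sum_range_sub]
    simp [F, htn]
  · rw [map_sum, Finset.sum_range_succ', Finset.sum_eq_zero]
    · simp [evalZeroOne_C, evalZeroOne_Y, ht0]
    · intro i _
      simp [evalZeroOne_X]

lemma exists_invariant (h : IsStandardExtension D U D' U') (hDU : IsFundamentalPair D U)
    {a : B} (ha : D a = 0) : ∃ f, D' f = 0 ∧ U' f = 0 ∧ evalZeroOne k B f = a := by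
  obtain ⟨s, x, hx, rfl⟩ := hDU.exists_sum a
  have hDx := eq_zero_of_sum_gradePiece (f := fun d => d + 2) (add_left_injective 2).injOn
    (fun d _ => hDU.map_D_mem (hx d)) (by rwa [map_sum] at ha)
  suffices ∑ d ∈ s, x d ∈ (kerSubalg D' ⊓ kerSubalg U').map (evalZeroOne k B) by
    obtain ⟨f, ⟨hf, hf'⟩, hfa⟩ := this
    exact ⟨f, hf, hf', hfa⟩
  refine sum_mem fun d hd => ?_
  rcases lt_or_ge d 0 with hneg | hpos
  · rw [hDU.eq_zero_of_neg (hx d) (hDx d hd) hneg]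
    exact zero_mem _
  · obtain ⟨n, rfl⟩ := Int.eq_ofNat_of_zero_le hpos
    obtain ⟨f, hf, hf', hfa⟩ := h.exists_invariant_of_mem hDU (hx n) (hDx n hd)
    exact ⟨f, ⟨hf, hf'⟩, hfa⟩

/-- Evaluation at `(0, 1)` identifies the invariants of `B[X, Y]` with the kernel of `D`. -/
noncomputable def invariantsEquiv (h : IsStandardExtension D U D' U')
    (hDU : IsFundamentalPair D U) : ↥(kerSubalg D' ⊓ kerSubalg U') ≃ₐ[k] ↥(kerSubalg D) :=
  AlgEquiv.ofBijective
    (((evalZeroOne k B).comp (kerSubalg D' ⊓ kerSubalg U').val).codRestrict (kerSubalg D)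
      fun f => (h.evalZeroOne_D f).symm.trans
        ((congrArg (evalZeroOne k B) f.2.1).trans (map_zero _))) <| by
    constructor
    · rw [injective_iff_map_eq_zero]
      intro f hf
      exact Subtype.ext (h.eq_zero_of_evalZeroOne f.2.1 f.2.2 (congrArg Subtype.val hf))
    · rintro ⟨a, ha⟩
      obtain ⟨f, hf, hf', hfa⟩ := h.exists_invariant hDU ha
      exact ⟨⟨f, hf, hf'⟩, Subtype.ext hfa⟩

end IsStandardExtension

end Extension

/-- for a fundamental pair `(D,U)` on an affine `k`-domain `B`, the kernel
`A = ker D` is a finitely generated `k`-algebra, and `A` is isomorphic to the ring of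
`SL₂(k)`-invariants `ker(D + X∂_Y) ∩ ker(U + Y∂_X)` of `B[X,Y]` (here `X = X 0`,
`Y = X 1`, and `D', U'` are the derivations of `B[X,Y]` extending `D, U` with
`D' X = 0, D' Y = X, U' X = Y, U' Y = 0`). -/
theorem stmt_9 {k B : Type*} [Field k] [CharZero k] [CommRing B] [IsDomain B] [Algebra k B]
    [Algebra.FiniteType k B]
    (D U : Derivation k B B) (hDU : IsFundamentalPair D U)
    (D' U' : Derivation k (MvPolynomial (Fin 2) B) (MvPolynomial (Fin 2) B))
    (hD'C : ∀ b : B, D' (C b) = C (D b))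
    (hD'X : D' (X 0) = 0) (hD'Y : D' (X 1) = X 0)
    (hU'C : ∀ b : B, U' (C b) = C (U b))
    (hU'X : U' (X 0) = X 1) (hU'Y : U' (X 1) = 0) :
    Algebra.FiniteType k ↥(kerSubalg D) ∧
    Nonempty (↥(kerSubalg D) ≃ₐ[k] ↥(kerSubalg D' ⊓ kerSubalg U')) := by
  have h : IsStandardExtension D U D' U' := ⟨hD'C, hD'X, hD'Y, hU'C, hU'X, hU'Y⟩
  have : Algebra.FiniteType k ↥(kerSubalg D' ⊓ kerSubalg U') :=
    have : Algebra.FiniteType k (MvPolynomial (Fin 2) B) :=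
      .trans ‹Algebra.FiniteType k B› inferInstance
    (Subalgebra.fg_iff_finiteType _).mp (h.isFundamentalPair hDU).invariants_fg
  exact ⟨this.equiv (h.invariantsEquiv hDU), ⟨(h.invariantsEquiv hDU).symm⟩⟩
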